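/- arXiv:2005.08574 — 2 statements merged into one kernel-verified Lean document; each statement's English description precedes it below -/
import Mathlib

section
/- Fix j′ ∈ {1,…,n}, a region Δ′ of the r-Shi arrangement S_{n−1}^r, an element i′ ∈ {0,1,…,n} \ {j′}, and, in case i′ ≠ 0, an element k′ ∈ {1,…,r}. Then there exists a region Δ of S_n^r such that: Proj_{j′}(Δ) = Δ′, where Proj_{j′} : ℝⁿ → ℝ^{n−1} deletes the j′-th coordinate; p_{j′}(Δ) = i′ and, if i′ ≠ 0, q_{j′}(Δ) = k′; and j′ ≠ p_j(Δ) for all j ∈ {1,…,n}. -/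
/-- The cubic matrix entry `c_{ijk}(x)`: equal to `xᵢ - xⱼ - k` if `i < j`, to `0` if
`i = j`, and to `xᵢ - xⱼ - k + 1` if `i > j` (here `k` is the actual value in `{1,…,r}`). -/
noncomputable def cEntry {n : ℕ} (x : Fin n → ℝ) (i j : Fin n) (k : ℕ) : ℝ :=
  if i < j then x i - x j - k else if j < i then x i - x j - k + 1 else 0

/-- The complement of the `r`-Shi arrangement in `ℝⁿ`, i.e. the set of points that are
generic for `S_n^r`: `c_{ijk}(x) ≠ 0` for all `i ≠ j` and `k ∈ {1,…,r}`. -/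
def shiCompl (r n : ℕ) : Set (Fin n → ℝ) :=
  {x | ∀ i j : Fin n, i ≠ j → ∀ k ∈ Finset.Icc 1 r, cEntry x i j k ≠ 0}

/-- The `j`-th column slice of the cubic matrix `C_x` has its (unique) minimal positive
entry at position `(p, q)`. -/
def IsMinPosAt (r : ℕ) {n : ℕ} (x : Fin n → ℝ) (j p : Fin n) (q : ℕ) : Prop :=
  q ∈ Finset.Icc 1 r ∧ 0 < cEntry x p j q ∧
    ∀ i : Fin n, ∀ k ∈ Finset.Icc 1 r, 0 < cEntry x i j k → cEntry x p j q ≤ cEntry x i j k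

open Filter Topology

/-- integer threshold -/
def shiTh {n : ℕ} (i j : Fin n) (k : ℕ) : ℤ := if j < i then (k : ℤ) - 1 else k

theorem cEntry_eq {n : ℕ} (x : Fin n → ℝ) {i j : Fin n} (h : i ≠ j) (k : ℕ) :
    cEntry x i j k = x i - x j - (shiTh i j k : ℝ) := by
  unfold cEntry shiTh
  rcases lt_or_gt_of_ne h with h1 | h1
  · simp [h1, not_lt.mpr h1.le]
  · simp [h1, not_lt.mpr h1.le]; ring

theorem cEntry_self {n : ℕ} (x : Fin n → ℝ) (i : Fin n) (k : ℕ) : cEntry x i i k = 0 := by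
  simp [cEntry]

theorem cEntry_convex {n : ℕ} (x y : Fin n → ℝ) (s t : ℝ) (h : s + t = 1) (i j : Fin n) (k : ℕ) :
    cEntry (s • x + t • y) i j k = s * cEntry x i j k + t * cEntry y i j k := by
  by_cases hij : i = j
  · subst hij; simp [cEntry_self]
  · simp only [cEntry_eq _ hij, Pi.add_apply, Pi.smul_apply, smul_eq_mul]
    have : s = 1 - t := by linarith
    subst this; ring

theorem cEntry_continuous {n : ℕ} (i j : Fin n) (k : ℕ) :
    Continuous (fun x : Fin n → ℝ => cEntry x i j k) := by
  by_cases hij : i = j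
  · subst hij; simp only [cEntry_self]; exact continuous_const
  · simp only [cEntry_eq _ hij]; fun_prop

theorem compare_entries {n r : ℕ} {i i' j : Fin n} (h1 : i ≠ j) (h2 : i' ≠ j) (h3 : i ≠ i')
    {k k' : ℕ} (hk : k ∈ Finset.Icc 1 r) (hk' : k' ∈ Finset.Icc 1 r) :
    ∃ l ∈ Finset.Icc 1 r,
      (∀ x : Fin n → ℝ, cEntry x i j k - cEntry x i' j k' = cEntry x i i' l) ∨
      (∀ x : Fin n → ℝ, cEntry x i j k - cEntry x i' j k' = - cEntry x i' i l) := by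
  have key : ∃ l ∈ Finset.Icc 1 r, shiTh i j k - shiTh i' j k' = shiTh i i' l ∨
      shiTh i j k - shiTh i' j k' = - shiTh i' i l := by
    simp only [Finset.mem_Icc] at *
    have e1 : (i : ℕ) ≠ j := fun h => h1 (Fin.ext h)
    have e2 : (i' : ℕ) ≠ j := fun h => h2 (Fin.ext h)
    have e3 : (i : ℕ) ≠ i' := fun h => h3 (Fin.ext h)
    unfold shiTh
    simp only [Fin.lt_def]
    obtain ⟨N, hN⟩ : ∃ N : ℤ, N = (if (j : ℕ) < i then (k : ℤ) - 1 else k) -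
      (if (j : ℕ) < i' then (k' : ℤ) - 1 else k') := ⟨_, rfl⟩
    rw [← hN]
    by_cases hlt : (i' : ℕ) < i
    · by_cases hp : 0 ≤ N
      · refine ⟨(N + 1).toNat, ?_, Or.inl ?_⟩ <;> split_ifs at * <;> omega
      · refine ⟨(-N).toNat, ?_, Or.inr ?_⟩ <;> split_ifs at * <;> omega
    · by_cases hp : 1 ≤ N
      · refine ⟨N.toNat, ?_, Or.inl ?_⟩ <;> split_ifs at * <;> omega
      · refine ⟨(1 - N).toNat, ?_, Or.inr ?_⟩ <;> split_ifs at * <;> omega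
  obtain ⟨l, hl, h | h⟩ := key
  · refine ⟨l, hl, Or.inl fun x => ?_⟩
    have := congrArg (fun z : ℤ => (z : ℝ)) h
    push_cast at this
    rw [cEntry_eq _ h1, cEntry_eq _ h2, cEntry_eq _ h3]; linarith
  · refine ⟨l, hl, Or.inr fun x => ?_⟩
    have := congrArg (fun z : ℤ => (z : ℝ)) h
    push_cast at this
    rw [cEntry_eq _ h1, cEntry_eq _ h2, cEntry_eq _ h3.symm]; linarith

theorem sign_of_mk_eq {r n : ℕ} (x y : ↥(shiCompl r n))
    (h : ConnectedComponents.mk x = ConnectedComponents.mk y) (a b : Fin n) (hab : a ≠ b)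
    (k : ℕ) (hk : k ∈ Finset.Icc 1 r) (hp : 0 < cEntry x.val a b k) : 0 < cEntry y.val a b k := by
  have hc : Continuous (fun z : ↥(shiCompl r n) => cEntry z.val a b k) :=
    (cEntry_continuous a b k).comp continuous_subtype_val
  have hcl : IsClopen {z : ↥(shiCompl r n) | 0 < cEntry z.val a b k} := by
    refine ⟨?_, isOpen_lt continuous_const hc⟩
    have : {z : ↥(shiCompl r n) | 0 < cEntry z.val a b k} = {z | 0 ≤ cEntry z.val a b k} := by
      ext z
      simp only [Set.mem_setOf_eq]
      exact ⟨fun h => le_of_lt h, fun h => lt_of_le_of_ne h (z.2 a b hab k hk).symm⟩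
    rw [this]
    exact isClosed_le continuous_const hc
  have hm : y ∈ connectedComponent x := ConnectedComponents.coe_eq_coe'.mp h.symm
  exact hcl.connectedComponent_subset hp hm

theorem mk_eq_of_sign {r n : ℕ} (x y : ↥(shiCompl r n))
    (h : ∀ a b : Fin n, a ≠ b → ∀ k ∈ Finset.Icc 1 r,
      (0 < cEntry x.val a b k ↔ 0 < cEntry y.val a b k)) :
    ConnectedComponents.mk x = ConnectedComponents.mk y := by
  let C : Set (Fin n → ℝ) := {z | ∀ a b : Fin n, a ≠ b → ∀ k ∈ Finset.Icc 1 r,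
    0 < cEntry x.val a b k * cEntry z a b k}
  have hC : Convex ℝ C := by
    intro u hu v hv s t hs ht hst a b hab k hk
    rw [cEntry_convex u v s t hst]
    have h1 := hu a b hab k hk
    have h2 := hv a b hab k hk
    rcases hs.eq_or_lt with h0 | h0
    · have : t = 1 := by linarith
      subst this; subst h0; simpa using h2
    · nlinarith [mul_pos h0 h1, mul_nonneg ht h2.le]
  have hsub : C ⊆ shiCompl r n := by
    intro z hz a b hab k hk h0
    have := hz a b hab k hk
    simp [h0] at this
  have hpre : IsPreconnected (Subtype.val ⁻¹' C : Set ↥(shiCompl r n)) := by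
    rw [← Topology.IsInducing.subtypeVal.isPreconnected_image]
    rw [Subtype.image_preimage_coe, Set.inter_eq_right.mpr hsub]
    exact hC.isPreconnected
  have hx : x ∈ (Subtype.val ⁻¹' C : Set ↥(shiCompl r n)) := by
    intro a b hab k hk
    exact mul_self_pos.mpr (x.2 a b hab k hk)
  have hy : y ∈ (Subtype.val ⁻¹' C : Set ↥(shiCompl r n)) := by
    intro a b hab k hk
    have h1 := x.2 a b hab k hk
    have h2 := y.2 a b hab k hk
    have h3 := h a b hab k hk
    rcases lt_or_gt_of_ne h1 with h4 | h4
    · have : ¬ 0 < cEntry y.val a b k := fun h5 => absurd (h3.mpr h5) (not_lt.mpr h4.le)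
      exact mul_pos_of_neg_of_neg h4 (lt_of_le_of_ne (not_lt.mp this) h2)
    · exact mul_pos h4 (h3.mp h4)
  exact ConnectedComponents.coe_eq_coe'.mpr (hpre.subset_connectedComponent hy hx)

theorem isMinPosAt_of_sign {r n : ℕ} {x y : Fin n → ℝ} (hx : x ∈ shiCompl r n)
    (hy : y ∈ shiCompl r n) (j : Fin n)
    (h : ∀ a b : Fin n, a ≠ b → a ≠ j → ∀ k ∈ Finset.Icc 1 r,
      (0 < cEntry x a b k ↔ 0 < cEntry y a b k)) {p : Fin n} {q : ℕ}
    (hm : IsMinPosAt r x j p q) : IsMinPosAt r y j p q := by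
  obtain ⟨hq, hpos, hmin⟩ := hm
  have hpj : p ≠ j := by rintro rfl; simp [cEntry_self] at hpos
  refine ⟨hq, (h p j hpj hpj q hq).mp hpos, ?_⟩
  intro i k hk hik
  have hij : i ≠ j := by rintro rfl; simp [cEntry_self] at hik
  have h1 := hmin i k hk ((h i j hij hij k hk).mpr hik)
  by_cases hip : i = p
  · subst hip
    rw [cEntry_eq _ hij, cEntry_eq _ hij] at *; linarith
  obtain ⟨l, hl, h2 | h2⟩ := compare_entries hij hpj hip hk hq
  · have h3 := h2 x
    have h4 := h2 y
    have h5 := hx i p hip l hl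
    have h6 : 0 < cEntry x i p l := lt_of_le_of_ne (by linarith) h5.symm
    have := (h i p hip hij l hl).mp h6
    linarith
  · have h3 := h2 x
    have h4 := h2 y
    have h6 : ¬ 0 < cEntry x p i l := by linarith
    rw [h p i (Ne.symm hip) hpj l hl] at h6
    linarith

theorem real_aux (u v C : ℝ) (d : ℤ) (h : (d : ℝ) ≤ u - v) :
    (d : ℝ) ≤ ((⌊u⌋ : ℝ) + max (Int.fract u) C) - ((⌊v⌋ : ℝ) + max (Int.fract v) C) := by
  have hu := Int.floor_add_fract u
  have hv := Int.floor_add_fract v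
  have h1 := Int.fract_nonneg u
  have h2 := Int.fract_lt_one u
  have h3 := Int.fract_nonneg v
  have h4 := Int.fract_lt_one v
  rcases lt_trichotomy (⌊u⌋ - ⌊v⌋) d with h5 | h5 | h5
  · have h6 : ⌊u⌋ - ⌊v⌋ + 1 ≤ d := h5
    have h7 : ((⌊u⌋ : ℝ)) - ⌊v⌋ + 1 ≤ d := by exact_mod_cast h6
    linarith
  · have h7 : ((⌊u⌋ : ℝ)) - ⌊v⌋ = d := by exact_mod_cast h5
    have : max (Int.fract v) C ≤ max (Int.fract u) C := max_le_max (by linarith) le_rfl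
    linarith
  · have h6 : d + 1 ≤ ⌊u⌋ - ⌊v⌋ := h5
    have h7 : (d : ℝ) + 1 ≤ ((⌊u⌋ : ℝ)) - ⌊v⌋ := by exact_mod_cast h6
    have : max (Int.fract v) C ≤ max (Int.fract u) C + 1 :=
      max_le (by linarith [le_max_left (Int.fract u) C]) (by linarith [le_max_right (Int.fract u) C])
    linarith

theorem exists_gap {r n : ℕ} (x : Fin n → ℝ) (j : Fin n) (c : ℝ) (j' : Fin n)
    (h : ∀ i, i ≠ j' → ∀ k ∈ Finset.Icc 1 r, 0 < cEntry x i j k → c < cEntry x i j k) :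
    ∃ δ : ℝ, 0 < δ ∧ δ ≤ 1 ∧ ∀ i, i ≠ j' → ∀ k ∈ Finset.Icc 1 r, 0 < cEntry x i j k →
      c + δ ≤ cEntry x i j k := by
  have : ∀ᶠ δ : ℝ in 𝓝[>] 0, ∀ i, ∀ k ∈ Finset.Icc 1 r, i ≠ j' → 0 < cEntry x i j k →
      c + δ ≤ cEntry x i j k := by
    rw [Filter.eventually_all]
    intro i
    rw [Filter.eventually_all_finset]
    intro k hk
    by_cases hi : i ≠ j' ∧ 0 < cEntry x i j k
    · have := h i hi.1 k hk hi.2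
      have h2 : Set.Ioo (0 : ℝ) (cEntry x i j k - c) ∈ 𝓝[>] (0 : ℝ) :=
        Ioo_mem_nhdsGT (by linarith)
      filter_upwards [h2] with δ hδ _ _
      linarith [hδ.2]
    · filter_upwards with δ h1 h2
      exact absurd ⟨h1, h2⟩ hi
  have h2 : Set.Ioo (0 : ℝ) 1 ∈ 𝓝[>] (0 : ℝ) := Ioo_mem_nhdsGT (by norm_num)
  obtain ⟨δ, h3, h4⟩ := (this.and h2).exists
  exact ⟨δ, h4.1, h4.2.le, fun i hi k hk hp => h3 i k hk hi hp⟩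

theorem weak_step {r n : ℕ} {x : Fin n → ℝ} (hx : x ∈ shiCompl r n) {j j' : Fin n} {q : ℕ}
    (hm : IsMinPosAt r x j j' q) :
    ∃ w : Fin n → ℝ,
      (∀ a b, a ≠ b → a ≠ j' → ∀ k ∈ Finset.Icc 1 r, 0 < cEntry x a b k → 0 ≤ cEntry w a b k) ∧
      (∀ a b, a ≠ b → ∀ k ∈ Finset.Icc 1 r, cEntry x a b k < 0 → cEntry w a b k ≤ 0) ∧
      cEntry w j' j q < 0 := by
  obtain ⟨hq, hpos, hmin⟩ := hm
  have hjj : j' ≠ j := by rintro rfl; simp [cEntry_self] at hpos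
  obtain ⟨c, hc⟩ : ∃ c, c = cEntry x j' j q := ⟨_, rfl⟩
  have hstrict : ∀ i, i ≠ j' → ∀ k ∈ Finset.Icc 1 r, 0 < cEntry x i j k → c < cEntry x i j k := by
    intro i hi k hk hp
    have hij : i ≠ j := by rintro rfl; simp [cEntry_self] at hp
    refine lt_of_le_of_ne (hc ▸ hmin i k hk hp) fun he => ?_
    obtain ⟨l, hl, h2 | h2⟩ := compare_entries hij hjj hi hk hq
    · exact hx i j' hi l hl (by have := h2 x; linarith)
    · exact hx j' i hi.symm l hl (by have := h2 x; linarith)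
  obtain ⟨δ, hδ, hδ1, hgap⟩ := exists_gap x j c j' hstrict
  rw [← hc] at hpos
  have hr1 : (1 : ℕ) ∈ Finset.Icc 1 r := by simp only [Finset.mem_Icc] at *; omega
  classical
  let L : Fin n → Prop := fun l => ¬ 0 < cEntry x l j 1
  let w : Fin n → ℝ := fun l => if L l then
    x j + ((⌊x l - x j⌋ : ℝ) + max (Int.fract (x l - x j)) (c + δ)) else x l
  have hwL : ∀ l, L l → w l = x j + ((⌊x l - x j⌋ : ℝ) + max (Int.fract (x l - x j)) (c + δ)) :=
    fun l h => if_pos h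
  have hwM : ∀ l, ¬ L l → w l = x l := fun l h => if_neg h
  have hup : ∀ l, L l → x l ≤ w l := by
    intro l hl
    rw [hwL l hl]
    have := Int.floor_add_fract (x l - x j)
    linarith [le_max_left (Int.fract (x l - x j)) (c + δ)]
  have hP : ∀ l, L l → ⌊x l - x j⌋ ≤ (if j < l then -1 else 0 : ℤ) := by
    intro l hl
    by_cases hlj : l = j
    · subst hlj; simp
    have h1 : cEntry x l j 1 < 0 := lt_of_le_of_ne (not_lt.mp hl) (hx l j hlj 1 hr1)
    rw [cEntry_eq _ hlj] at h1
    unfold shiTh at h1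
    split_ifs with h2
    · have : ⌊x l - x j⌋ < 0 := by
        rw [Int.floor_lt]; simp [h2] at h1; push_cast; linarith
      omega
    · have : ⌊x l - x j⌋ < 1 := by
        rw [Int.floor_lt]; simp [h2] at h1; push_cast; linarith
      omega
  have hLj : L j := by simp [L, cEntry_self]
  have hMj' : ¬ L j' := by
    simp only [L, not_not]
    have h1 := hpos
    rw [hc, cEntry_eq _ hjj] at h1
    rw [cEntry_eq _ hjj]
    have : shiTh j' j 1 ≤ shiTh j' j q := by
      unfold shiTh; simp only [Finset.mem_Icc] at hq; split_ifs <;> omega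
    have : (shiTh j' j 1 : ℝ) ≤ shiTh j' j q := by exact_mod_cast this
    linarith
  have hMne : ∀ a, ¬ L a → a ≠ j := fun a h h' => h (h' ▸ hLj)
  have hLne : ∀ a, L a → a ≠ j' := fun a h h' => hMj' (h' ▸ h)
  -- gap in M
  have hgapM : ∀ a, ¬ L a → a ≠ j' → ∀ e : ℤ, (e : ℝ) < x a - x j →
      e ≤ (if j < a then (r : ℤ) - 1 else r) → (e : ℝ) + (c + δ) ≤ x a - x j := by
    intro a ha haj' e he her
    have haj := hMne a ha
    have ha1 : 0 < cEntry x a j 1 := not_not.mp ha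
    obtain ⟨k, hk, hek, hkp⟩ : ∃ k ∈ Finset.Icc 1 r, e ≤ shiTh a j k ∧ 0 < cEntry x a j k := by
      by_cases h1 : e ≤ shiTh a j 1
      · exact ⟨1, hr1, h1, ha1⟩
      · have h3 : shiTh a j (if j < a then e + 1 else e).toNat = e := by
          unfold shiTh at *; split_ifs at * <;> omega
        refine ⟨(if j < a then e + 1 else e).toNat, ?_, h3.ge, ?_⟩
        · simp only [Finset.mem_Icc] at *
          unfold shiTh at h1
          split_ifs at * <;> omega
        · rw [cEntry_eq _ haj, h3]; linarith
    have h2 := hgap a haj' k hk hkp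
    rw [cEntry_eq _ haj] at h2
    have : (e : ℝ) ≤ shiTh a j k := by exact_mod_cast hek
    linarith
  refine ⟨w, ?_, ?_, ?_⟩
  · intro a b hab haj' k hk hp
    rw [cEntry_eq _ hab] at hp ⊢
    by_cases ha : L a <;> by_cases hb : L b
    · rw [hwL a ha, hwL b hb]
      have := real_aux (x a - x j) (x b - x j) (c + δ) (shiTh a b k) (by linarith)
      linarith
    · rw [hwM b hb]
      linarith [hup a ha]
    · rw [hwM a ha, hwL b hb]
      have hfl := Int.floor_add_fract (x b - x j)
      have hf0 := Int.fract_nonneg (x b - x j)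
      rcases max_choice (Int.fract (x b - x j)) (c + δ) with h1 | h1
      · rw [h1]; linarith
      · rw [h1]
        have h2 := hgapM a ha haj' (shiTh a b k + ⌊x b - x j⌋) (by push_cast; linarith) (by
          have h3 := hP b hb
          simp only [Finset.mem_Icc] at hk
          have e1 : (a : ℕ) ≠ b := fun h => hab (Fin.ext h)
          have e2 : (a : ℕ) ≠ j := fun h => hMne a ha (Fin.ext h)
          unfold shiTh
          simp only [Fin.lt_def] at *
          split_ifs at * <;> omega)
        push_cast at h2
        linarith
    · rw [hwM a ha, hwM b hb]; linarith
  · intro b a hba k hk hp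
    rw [cEntry_eq _ hba] at hp ⊢
    by_cases ha : L a <;> by_cases hb : L b
    · rw [hwL a ha, hwL b hb]
      have := real_aux (x a - x j) (x b - x j) (c + δ) (- shiTh b a k) (by push_cast; linarith)
      push_cast at this
      linarith
    · rw [hwM b hb]
      linarith [hup a ha]
    · rw [hwM a ha, hwL b hb]
      have hfl := Int.floor_add_fract (x b - x j)
      have hf0 := Int.fract_nonneg (x b - x j)
      have h3 := hP b hb
      simp only [Finset.mem_Icc] at hk hq
      rcases max_choice (Int.fract (x b - x j)) (c + δ) with h1 | h1
      · rw [h1]; linarith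
      · rw [h1]
        by_cases haj' : a = j'
        · subst haj'
          rw [cEntry_eq _ hjj] at hc
          have : ⌊x b - x j⌋ - shiTh b a k + 1 ≤ shiTh a j q := by
            unfold shiTh
            simp only [Fin.lt_def] at *
            split_ifs at * <;> omega
          have : (⌊x b - x j⌋ : ℝ) - shiTh b a k + 1 ≤ shiTh a j q := by exact_mod_cast this
          linarith
        · have ha1 : 0 < cEntry x a j 1 := not_not.mp ha
          have h2 := hgap a haj' 1 hr1 ha1
          rw [cEntry_eq _ (hMne a ha)] at h2
          have : ⌊x b - x j⌋ - shiTh b a k ≤ shiTh a j 1 := by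
            unfold shiTh
            simp only [Fin.lt_def] at *
            split_ifs at * <;> omega
          have : (⌊x b - x j⌋ : ℝ) - shiTh b a k ≤ shiTh a j 1 := by exact_mod_cast this
          linarith
    · rw [hwM a ha, hwM b hb]; linarith
  · rw [cEntry_eq _ hjj] at hc ⊢
    rw [hwM _ hMj', hwL _ hLj]
    simp only [sub_self, Int.floor_zero, Int.fract_zero, Int.cast_zero, zero_add]
    linarith [le_max_right 0 (c + δ)]

theorem strict_step {r n : ℕ} {x : Fin n → ℝ} (hx : x ∈ shiCompl r n) {j j' : Fin n} {q : ℕ}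
    (hm : IsMinPosAt r x j j' q) :
    ∃ y ∈ shiCompl r n,
      (∀ a b, a ≠ b → a ≠ j' → ∀ k ∈ Finset.Icc 1 r, (0 < cEntry x a b k ↔ 0 < cEntry y a b k)) ∧
      (∀ b, ∀ k ∈ Finset.Icc 1 r, 0 < cEntry y j' b k → 0 < cEntry x j' b k) ∧
      cEntry y j' j q < 0 := by
  obtain ⟨w, h1, h2, h3⟩ := weak_step hx hm
  have hlim : ∀ a b k, Tendsto (fun t : ℝ => (1 - t) * cEntry x a b k + t * cEntry w a b k)
      (𝓝[<] 1) (𝓝 (cEntry w a b k)) := by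
    intro a b k
    have : Continuous (fun t : ℝ => (1 - t) * cEntry x a b k + t * cEntry w a b k) := by fun_prop
    have h := (this.tendsto 1).mono_left (nhdsWithin_le_nhds (s := Set.Iio 1))
    simpa using h
  have hI : Set.Ioo (0 : ℝ) 1 ∈ 𝓝[<] (1 : ℝ) := Ioo_mem_nhdsLT (by norm_num)
  have hne : ∀ᶠ t : ℝ in 𝓝[<] 1, ∀ a b, ∀ k ∈ Finset.Icc 1 r, a ≠ b →
      (1 - t) * cEntry x a b k + t * cEntry w a b k ≠ 0 := by
    rw [Filter.eventually_all]; intro a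
    rw [Filter.eventually_all]; intro b
    rw [Filter.eventually_all_finset]; intro k hk
    by_cases hab : a = b
    · filter_upwards with t h; exact absurd hab h
    by_cases h0 : cEntry w a b k = 0
    · filter_upwards [hI] with t ht _
      rw [h0, mul_zero, add_zero]
      exact mul_ne_zero (by linarith [ht.2]) (hx a b hab k hk)
    · filter_upwards [(hlim a b k).eventually_ne h0] with t ht _
      exact ht
  have hneg := (hlim j' j q).eventually_lt_const h3
  obtain ⟨t, ⟨ht2, ht3⟩, ht1⟩ := ((hne.and hneg).and hI).exists
  have hc := fun a b k => cEntry_convex x w (1 - t) t (by ring) a b k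
  have ht0 : 0 < t := ht1.1
  have ht4 : 0 < 1 - t := by linarith [ht1.2]
  have hnn : ∀ a b, a ≠ b → ∀ k ∈ Finset.Icc 1 r, 0 < cEntry ((1 - t) • x + t • w) a b k →
      0 < cEntry x a b k := by
    intro a b hab k hk hp
    by_contra hn
    have hn := lt_of_le_of_ne (not_lt.mp hn) (hx a b hab k hk)
    have := h2 a b hab k hk hn
    rw [hc] at hp
    nlinarith
  refine ⟨(1 - t) • x + t • w, ?_, ?_, ?_, ?_⟩
  · intro a b hab k hk
    rw [hc]; exact ht2 a b k hk hab
  · intro a b hab haj k hk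
    refine ⟨fun hp => ?_, hnn a b hab k hk⟩
    have := h1 a b hab haj k hk hp
    rw [hc]
    have := mul_pos ht4 hp
    positivity
  · intro b k hk hp
    have hb : j' ≠ b := by rintro rfl; simp [cEntry_self] at hp
    exact hnn j' b hb k hk hp
  · rw [hc]; exact ht3

theorem descent {r n : ℕ} (j' : Fin n) (x0 : Fin n → ℝ) (hx0 : x0 ∈ shiCompl r n) :
    ∃ y ∈ shiCompl r n,
      (∀ a b, a ≠ b → a ≠ j' → ∀ k ∈ Finset.Icc 1 r,
        (0 < cEntry x0 a b k ↔ 0 < cEntry y a b k)) ∧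
      ∀ j q, ¬ IsMinPosAt r y j j' q := by
  classical
  let cnt : (Fin n → ℝ) → ℕ := fun x =>
    ((Finset.univ ×ˢ Finset.Icc 1 r).filter fun p : Fin n × ℕ => 0 < cEntry x j' p.1 p.2).card
  suffices H : ∀ N : ℕ, ∀ x0 ∈ shiCompl r n, cnt x0 = N → ∃ y ∈ shiCompl r n,
      (∀ a b, a ≠ b → a ≠ j' → ∀ k ∈ Finset.Icc 1 r,
        (0 < cEntry x0 a b k ↔ 0 < cEntry y a b k)) ∧
      ∀ j q, ¬ IsMinPosAt r y j j' q from H _ x0 hx0 rfl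
  intro N
  induction N using Nat.strong_induction_on with
  | _ N ih =>
    intro x hx hN
    by_cases hex : ∃ j q, IsMinPosAt r x j j' q
    · obtain ⟨j, q, hm⟩ := hex
      obtain ⟨y, hy, h1, h2, h3⟩ := strict_step hx hm
      have hlt : cnt y < N := by
        rw [← hN]
        apply Finset.card_lt_card
        rw [Finset.ssubset_iff_of_subset]
        · refine ⟨(j, q), ?_, ?_⟩
          · simp only [Finset.mem_filter, Finset.mem_product, Finset.mem_univ, true_and]
            exact ⟨hm.1, hm.2.1⟩
          · simp only [Finset.mem_filter, not_and, not_lt]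
            exact fun _ => h3.le
        · intro p hp
          simp only [Finset.mem_filter, Finset.mem_product, Finset.mem_univ, true_and] at hp ⊢
          exact ⟨hp.1, h2 _ _ hp.1 hp.2⟩
      obtain ⟨z, hz, h4, h5⟩ := ih _ hlt y hy rfl
      exact ⟨z, hz, fun a b hab ha k hk => (h1 a b hab ha k hk).trans (h4 a b hab ha k hk), h5⟩
    · push Not at hex
      exact ⟨x, hx, fun _ _ _ _ _ _ => Iff.rfl, hex⟩

theorem cEntry_succAbove {m : ℕ} (j' : Fin (m + 1)) (x : Fin (m + 1) → ℝ) (a b : Fin m) (k : ℕ) :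
    cEntry (fun i : Fin m => x (j'.succAbove i)) a b k =
      cEntry x (j'.succAbove a) (j'.succAbove b) k := by
  simp only [cEntry, Fin.succAbove_lt_succAbove_iff]

theorem base_point (r m : ℕ) (j' : Fin (m + 1)) (x' : Fin m → ℝ) (hx' : x' ∈ shiCompl r m)
    (i' : Option (Fin (m + 1))) (hi' : i' ≠ some j')
    (k' : ℕ) (hk' : i' ≠ none → k' ∈ Finset.Icc 1 r) :
    ∃ x ∈ shiCompl r (m + 1), (∀ i, x (j'.succAbove i) = x' i) ∧
      (i' = none → ∀ i, ∀ k ∈ Finset.Icc 1 r, ¬ 0 < cEntry x i j' k) ∧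
      (∀ p, i' = some p → IsMinPosAt r x j' p k') := by
  let X : ℝ → Fin (m + 1) → ℝ := fun t => j'.insertNth t x'
  have hXj : ∀ t, X t j' = t := fun t => by simp [X]
  have hXs : ∀ t i, X t (j'.succAbove i) = x' i := fun t i => by simp [X]
  have hX0 : ∀ t a, a ≠ j' → X t a = X 0 a := by
    intro t a ha
    obtain ⟨i, rfl⟩ := Fin.exists_succAbove_eq ha
    rw [hXs, hXs]
  have hgen : ∀ t, (∀ i, ∀ k ∈ Finset.Icc 1 r, i ≠ j' →
      t ≠ X 0 i - (shiTh i j' k : ℝ) ∧ t ≠ X 0 i + (shiTh j' i k : ℝ)) →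
      X t ∈ shiCompl r (m + 1) := by
    intro t ht a b hab k hk h0
    by_cases ha : a = j'
    · subst ha
      rw [cEntry_eq _ hab, hXj, hX0 t b hab.symm] at h0
      exact (ht b k hk hab.symm).2 (by linarith)
    by_cases hb : b = j'
    · subst hb
      rw [cEntry_eq _ hab, hXj, hX0 t a hab] at h0
      exact (ht a k hk hab).1 (by linarith)
    obtain ⟨a, rfl⟩ := Fin.exists_succAbove_eq ha
    obtain ⟨b, rfl⟩ := Fin.exists_succAbove_eq hb
    rw [← cEntry_succAbove] at h0
    simp only [hXs] at h0
    exact hx' a b (fun h => hab (by rw [h])) k hk h0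
  cases i' with
  | none =>
    have : ∀ᶠ t : ℝ in atTop, ∀ i, ∀ k ∈ Finset.Icc 1 r,
        X 0 i - (shiTh i j' k : ℝ) < t ∧ X 0 i + (shiTh j' i k : ℝ) < t := by
      rw [Filter.eventually_all]; intro i
      rw [Filter.eventually_all_finset]; intro k hk
      exact (eventually_gt_atTop _).and (eventually_gt_atTop _)
    obtain ⟨t, ht⟩ := this.exists
    refine ⟨X t, hgen t fun i k hk _ => ⟨(ht i k hk).1.ne', (ht i k hk).2.ne'⟩, hXs t, ?_, ?_⟩
    · intro _ i k hk hp
      have hij : i ≠ j' := by rintro rfl; simp [cEntry_self] at hp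
      rw [cEntry_eq _ hij, hXj, hX0 t i hij] at hp
      linarith [(ht i k hk).1]
    · intro p hp; cases hp
  | some p =>
    have hp : p ≠ j' := fun h => hi' (by rw [h])
    have hk := hk' (by simp)
    obtain ⟨v, hv⟩ : ∃ v, v = X 0 p - (shiTh p j' k' : ℝ) := ⟨_, rfl⟩
    have hev : ∀ u : ℝ, ∀ᶠ t in 𝓝[<] v, t ≠ u ∧ (u < v → u < t) := by
      intro u
      by_cases hu : u < v
      · filter_upwards [Ioo_mem_nhdsLT hu] with t ht
        exact ⟨ht.1.ne', fun _ => ht.1⟩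
      · filter_upwards [self_mem_nhdsWithin] with t ht
        have : t < v := ht
        exact ⟨by linarith [not_lt.mp hu] |> fun h : t < u => h.ne, fun h => absurd h hu⟩
    have : ∀ᶠ t : ℝ in 𝓝[<] v, ∀ i, ∀ k ∈ Finset.Icc 1 r,
        (t ≠ X 0 i - (shiTh i j' k : ℝ) ∧
          (X 0 i - (shiTh i j' k : ℝ) < v → X 0 i - (shiTh i j' k : ℝ) < t)) ∧
        (t ≠ X 0 i + (shiTh j' i k : ℝ) ∧
          (X 0 i + (shiTh j' i k : ℝ) < v → X 0 i + (shiTh j' i k : ℝ) < t)) := by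
      rw [Filter.eventually_all]; intro i
      rw [Filter.eventually_all_finset]; intro k hk
      exact (hev _).and (hev _)
    obtain ⟨t, ht, htv⟩ := (this.and self_mem_nhdsWithin).exists
    have htv : t < v := htv
    refine ⟨X t, hgen t fun i k hk _ => ⟨(ht i k hk).1.1, (ht i k hk).2.1⟩, hXs t, ?_, ?_⟩
    · intro h; cases h
    · intro p' hp'
      cases hp'
      refine ⟨hk, ?_, ?_⟩
      · rw [cEntry_eq _ hp, hXj, hX0 t p hp]; linarith
      · intro i k hkk hpos
        have hij : i ≠ j' := by rintro rfl; simp [cEntry_self] at hpos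
        rw [cEntry_eq _ hij, hXj, hX0 t i hij] at hpos ⊢
        rw [cEntry_eq _ hp, hXj, hX0 t p hp]
        by_contra hcon
        have := (ht i k hkk).1.2 (by linarith)
        linarith

/-- Existence of a region with prescribed projection and prescribed father data at a fixed
coordinate `j′` (here the ambient dimension is `m + 1`, so `S_{n}^r` with `n = m+1 ≥ 2` and
`S_{n-1}^r` lives in `ℝ^m`): given a region `Δ′` of `S_m^r`, an index `i′` (with `i′ = none`
encoding `0`), `i′ ≠ j′`, and `k′ ∈ {1,…,r}` in case `i′ ≠ 0`, there is a region `Δ` of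
`S_{m+1}^r` whose projection (deleting the `j′`-th coordinate) is `Δ′`, with
`p_{j′}(Δ) = i′`, `q_{j′}(Δ) = k′` if `i′ ≠ 0`, and `p_j(Δ) ≠ j′` for all `j`. -/
theorem region_with_prescribed_projection_exists (r m : ℕ) (hr : 0 < r) (hm : 0 < m)
    (j' : Fin (m + 1)) (Δ' : ConnectedComponents ↥(shiCompl r m))
    (i' : Option (Fin (m + 1))) (hi' : i' ≠ some j')
    (k' : ℕ) (hk' : i' ≠ none → k' ∈ Finset.Icc 1 r) :
    ∃ Δ : ConnectedComponents ↥(shiCompl r (m + 1)),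
      ∀ x : ↥(shiCompl r (m + 1)), ConnectedComponents.mk x = Δ →
        (∃ hx' : (fun i : Fin m => x.val (j'.succAbove i)) ∈ shiCompl r m,
            ConnectedComponents.mk (⟨_, hx'⟩ : ↥(shiCompl r m)) = Δ') ∧
        (i' = none → ¬∃ i : Fin (m + 1), ∃ k ∈ Finset.Icc 1 r, 0 < cEntry x.val i j' k) ∧
        (∀ p : Fin (m + 1), i' = some p → IsMinPosAt r x.val j' p k') ∧
        (∀ j : Fin (m + 1), ∀ q : ℕ, ¬IsMinPosAt r x.val j j' q) := by
  obtain ⟨x', rfl⟩ := ConnectedComponents.surjective_coe Δ'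
  obtain ⟨x0, hx0, hs, hnone, hsome⟩ := base_point r m j' x'.val x'.2 i' hi' k' hk'
  obtain ⟨y, hy, hsign, hno⟩ := descent j' x0 hx0
  refine ⟨ConnectedComponents.mk ⟨y, hy⟩, fun x hxy => ?_⟩
  have hxs : ∀ a b, a ≠ b → ∀ k ∈ Finset.Icc 1 r,
      (0 < cEntry x.val a b k ↔ 0 < cEntry y a b k) := fun a b hab k hk =>
    ⟨sign_of_mk_eq x ⟨y, hy⟩ hxy a b hab k hk, sign_of_mk_eq ⟨y, hy⟩ x hxy.symm a b hab k hk⟩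
  have hx0x : ∀ a b, a ≠ b → a ≠ j' → ∀ k ∈ Finset.Icc 1 r,
      (0 < cEntry x0 a b k ↔ 0 < cEntry x.val a b k) := fun a b hab ha k hk =>
    (hsign a b hab ha k hk).trans (hxs a b hab k hk).symm
  have hinj : ∀ {a b : Fin m}, a ≠ b → j'.succAbove a ≠ j'.succAbove b := fun hab h =>
    hab (Fin.succAbove_right_injective h)
  refine ⟨⟨?_, ?_⟩, ?_, ?_, ?_⟩
  · intro a b hab k hk
    rw [cEntry_succAbove]
    exact x.2 _ _ (hinj hab) k hk
  · apply mk_eq_of_sign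
    intro a b hab k hk
    have h1 : x'.val = fun i => x0 (j'.succAbove i) := by funext i; rw [hs]
    rw [h1]
    simp only [cEntry_succAbove]
    exact (hx0x _ _ (hinj hab) (Fin.succAbove_ne j' a) k hk).symm
  · rintro hi ⟨i, k, hk, hpos⟩
    have hij : i ≠ j' := by rintro rfl; simp [cEntry_self] at hpos
    exact hnone hi i k hk ((hx0x i j' hij hij k hk).mpr hpos)
  · intro p hp
    exact isMinPosAt_of_sign hx0 x.2 j' (fun a b hab ha k hk => hx0x a b hab ha k hk) (hsome p hp)
  · intro j q hm
    exact hno j q (isMinPosAt_of_sign x.2 hy j (fun a b hab _ k hk => hxs a b hab k hk) hm)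
end

section
/- Let Δ and Ω be regions of the r-Shi arrangement S_n^r such that for every j ∈ {1,…,n}: the j-th column slice has a positive entry for Δ if and only if it does for Ω, and, when both do, p_j(Δ) = p_j(Ω) and q_j(Δ) = q_j(Ω). Then Δ = Ω. In particular, the map sending a region Δ to the tuple ((p_j(Δ), q_j(Δ)))_{j=1}^{n} is injective on the set of regions of S_n^r. -/
theorem shi_pos_lt {n : ℕ} {x : Fin n → ℝ} {i j : Fin n} {k : ℕ} (hk : 1 ≤ k)
    (h : 0 < cEntry x i j k) : x j < x i := by
  have hk' : (1 : ℝ) ≤ k := by exact_mod_cast hk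
  unfold cEntry at h
  split_ifs at h <;> linarith

theorem shi_exists_min {r n : ℕ} {x : Fin n → ℝ} {j : Fin n} {i : Fin n} {k : ℕ}
    (hk : k ∈ Finset.Icc 1 r) (h : 0 < cEntry x i j k) : ∃ p q, IsMinPosAt r x j p q := by
  classical
  obtain ⟨⟨p, q⟩, hm, hmin⟩ := Finset.exists_min_image
    (((Finset.univ : Finset (Fin n)) ×ˢ Finset.Icc 1 r).filter
      (fun a => 0 < cEntry x a.1 j a.2)) (fun a => cEntry x a.1 j a.2)
    ⟨(i, k), by simp only [Finset.mem_filter, Finset.mem_product, Finset.mem_univ, true_and]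
                exact ⟨hk, h⟩⟩
  simp only [Finset.mem_filter, Finset.mem_product, Finset.mem_univ, true_and] at hm hmin
  exact ⟨p, q, hm.1, hm.2, fun i k hk h => hmin (i, k) ⟨hk, h⟩⟩

def ShiSame (r : ℕ) {n : ℕ} (T : Finset (Fin n)) (x y : Fin n → ℝ) : Prop :=
  ∀ i ∈ T, ∀ p ∈ T, ∀ k ∈ Finset.Icc 1 r, (0 < cEntry x i p k ↔ 0 < cEntry y i p k)

theorem ShiSame.symm {r n : ℕ} {T : Finset (Fin n)} {x y : Fin n → ℝ} (h : ShiSame r T x y) :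
    ShiSame r T y x := fun i hi p hp k hk => (h i hi p hp k hk).symm

theorem cEntry_of_lt {n : ℕ} (x : Fin n → ℝ) {i j : Fin n} (k : ℕ) (h : i < j) :
    cEntry x i j k = x i - x j - k := by simp [cEntry, h]

theorem cEntry_of_gt {n : ℕ} (x : Fin n → ℝ) {i j : Fin n} (k : ℕ) (h : j < i) :
    cEntry x i j k = x i - x j - k + 1 := by simp [cEntry, h, h.not_gt]

/-- transfer of an inequality `x i - x p ≥ m`, `i < p`. -/
theorem shi_transfer_lt {r n : ℕ} {T : Finset (Fin n)} {x y : Fin n → ℝ}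
    (hx : x ∈ shiCompl r n) (hS : ShiSame r T x y) {i p : Fin n} (hi : i ∈ T) (hp : p ∈ T)
    (hip : i < p) (m : ℤ) (h1 : -(r : ℤ) + 1 ≤ m) (h2 : m ≤ r) (h : (m : ℝ) ≤ x i - x p) :
    (m : ℝ) ≤ y i - y p := by
  rcases le_or_gt 1 m with hm | hm
  · obtain ⟨k, rfl⟩ := Int.eq_ofNat_of_zero_le (by omega : 0 ≤ m)
    have hk : k ∈ Finset.Icc 1 r := by simp; omega
    have a := hx i p hip.ne k hk
    have b := hS i hi p hp k hk
    rw [cEntry_of_lt _ _ hip] at a b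
    rw [cEntry_of_lt _ _ hip] at b
    push_cast at *
    have := b.1 (lt_of_le_of_ne (by linarith) a.symm)
    linarith
  · obtain ⟨k, hk'⟩ := Int.eq_ofNat_of_zero_le (by omega : 0 ≤ 1 - m)
    have hk : k ∈ Finset.Icc 1 r := by simp; omega
    have b := hS p hp i hi k hk
    rw [cEntry_of_gt _ _ hip, cEntry_of_gt _ _ hip] at b
    have e : (m : ℝ) = 1 - k := by
      have : m = 1 - (k : ℤ) := by omega
      rw [this]; push_cast; ring
    by_contra hc
    have := b.2 (by linarith)
    linarith

theorem shi_transfer_gt {r n : ℕ} {T : Finset (Fin n)} {x y : Fin n → ℝ}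
    (hx : x ∈ shiCompl r n) (hS : ShiSame r T x y) {i p : Fin n} (hi : i ∈ T) (hp : p ∈ T)
    (hip : p < i) (m : ℤ) (h1 : -(r : ℤ) ≤ m) (h2 : m ≤ r - 1) (h : (m : ℝ) ≤ x i - x p) :
    (m : ℝ) ≤ y i - y p := by
  rcases le_or_gt 0 m with hm | hm
  · obtain ⟨k, hk'⟩ := Int.eq_ofNat_of_zero_le (by omega : 0 ≤ m + 1)
    have hk : k ∈ Finset.Icc 1 r := by simp; omega
    have a := hx i p hip.ne' k hk
    have b := hS i hi p hp k hk
    rw [cEntry_of_gt _ _ hip] at a b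
    rw [cEntry_of_gt _ _ hip] at b
    have e : (m : ℝ) = k - 1 := by
      have : m = (k : ℤ) - 1 := by omega
      rw [this]; push_cast; ring
    have := b.1 (lt_of_le_of_ne (by linarith) a.symm)
    linarith
  · obtain ⟨k, hk'⟩ := Int.eq_ofNat_of_zero_le (by omega : 0 ≤ - m)
    have hk : k ∈ Finset.Icc 1 r := by simp; omega
    have b := hS p hp i hi k hk
    rw [cEntry_of_lt _ _ hip, cEntry_of_lt _ _ hip] at b
    have e : (m : ℝ) = - k := by
      have : m = - (k : ℤ) := by omega
      rw [this]; push_cast; ring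
    by_contra hc
    have := b.2 (by linarith)
    linarith

theorem shi_det {r n : ℕ} {T : Finset (Fin n)} {x y : Fin n → ℝ}
    (hx : x ∈ shiCompl r n) (hS : ShiSame r T x y) {j : Fin n}
    (H : ∀ p q, IsMinPosAt r x j p q → IsMinPosAt r y j p q)
    (hf : ∀ p q, IsMinPosAt r x j p q → p ∈ T) {i : Fin n} (hi : i ∈ T) {k : ℕ}
    (hk : k ∈ Finset.Icc 1 r) (h : 0 < cEntry x i j k) : 0 < cEntry y i j k := by
  obtain ⟨p, q, hpq⟩ := shi_exists_min hk h
  have hp := hf p q hpq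
  have hy := (H p q hpq).2.1
  obtain ⟨hq, hpos, hmin⟩ := hpq
  have hle := hmin i k hk h
  have hij : i ≠ j := by rintro rfl; simp [cEntry] at h
  have hpj : p ≠ j := by rintro rfl; simp [cEntry] at hpos
  simp only [Finset.mem_Icc] at hk hq
  rcases lt_trichotomy i p with hip | rfl | hip
  · rcases lt_or_gt_of_ne hij with a | a <;> rcases lt_or_gt_of_ne hpj with b | b
    · rw [cEntry_of_lt _ _ a, cEntry_of_lt _ _ b] at *
      have := shi_transfer_lt hx hS hi hp hip ((k : ℤ) - q) (by omega) (by omega)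
        (by push_cast; linarith)
      push_cast at this; linarith
    · rw [cEntry_of_lt _ _ a, cEntry_of_gt _ _ b] at *
      have := shi_transfer_lt hx hS hi hp hip ((k : ℤ) - q + 1) (by omega) (by omega)
        (by push_cast; linarith)
      push_cast at this; linarith
    · exact absurd (a.trans hip) b.not_gt
    · rw [cEntry_of_gt _ _ a, cEntry_of_gt _ _ b] at *
      have := shi_transfer_lt hx hS hi hp hip ((k : ℤ) - q) (by omega) (by omega)
        (by push_cast; linarith)
      push_cast at this; linarith
  · rcases lt_or_gt_of_ne hij with a | a
    · simp only [cEntry_of_lt _ _ a] at *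
      linarith
    · simp only [cEntry_of_gt _ _ a] at *
      linarith
  · rcases lt_or_gt_of_ne hij with a | a <;> rcases lt_or_gt_of_ne hpj with b | b
    · rw [cEntry_of_lt _ _ a, cEntry_of_lt _ _ b] at *
      have := shi_transfer_gt hx hS hi hp hip ((k : ℤ) - q) (by omega) (by omega)
        (by push_cast; linarith)
      push_cast at this; linarith
    · exact absurd (hip.trans a) b.not_gt
    · rw [cEntry_of_gt _ _ a, cEntry_of_lt _ _ b] at *
      have := shi_transfer_gt hx hS hi hp hip ((k : ℤ) - q - 1) (by omega) (by omega)
        (by push_cast; linarith)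
      push_cast at this; linarith
    · rw [cEntry_of_gt _ _ a, cEntry_of_gt _ _ b] at *
      have := shi_transfer_gt hx hS hi hp hip ((k : ℤ) - q) (by omega) (by omega)
        (by push_cast; linarith)
      push_cast at this; linarith

theorem shi_ne {r n : ℕ} (hr : 0 < r) {x : Fin n → ℝ} (hx : x ∈ shiCompl r n) {i j : Fin n}
    (h : i < j) : x i ≠ x j := by
  intro e
  have := hx j i h.ne' 1 (by simp; omega)
  rw [cEntry_of_gt _ _ h] at this
  apply this; push_cast; linarith

theorem shi_father_mem {r n : ℕ} {T : Finset (Fin n)} {x : Fin n → ℝ} {j : Fin n}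
    (hm : ∀ l, l ∉ T → x l ≤ x j) (p : Fin n) (q : ℕ) (h : IsMinPosAt r x j p q) : p ∈ T := by
  by_contra hp
  have := shi_pos_lt (Finset.mem_Icc.1 h.1).1 h.2.1
  linarith [hm p hp]

theorem shi_key {r n : ℕ} (hr : 0 < r) {T : Finset (Fin n)} {x y : Fin n → ℝ}
    (hx : x ∈ shiCompl r n) (hy : y ∈ shiCompl r n)
    (H : ∀ j p q, IsMinPosAt r x j p q ↔ IsMinPosAt r y j p q)
    (hS : ShiSame r T x y)
    (uy : ∀ i ∈ T, ∀ l, y i < y l → l ∈ T) {j j' : Fin n} (hj : j ∉ T) (hj' : j' ∉ T)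
    (mx : ∀ l, l ∉ T → x l ≤ x j) (my : ∀ l, l ∉ T → y l ≤ y j') (hlt : j < j') : False := by
  have h1 : x j' < x j := lt_of_le_of_ne (mx j' hj') (shi_ne hr hx hlt).symm
  have h2 : y j < y j' := lt_of_le_of_ne (my j hj) (shi_ne hr hy hlt)
  have e1 : 0 < cEntry y j' j 1 := by
    rw [cEntry_of_gt _ _ hlt]; push_cast; linarith
  have m1 : 1 ∈ Finset.Icc 1 r := by simp; omega
  obtain ⟨p, q, hpq⟩ := shi_exists_min m1 e1
  have hxpq := (H j p q).2 hpq
  have hp := shi_father_mem mx p q hxpq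
  have hxpos := hxpq.2.1
  obtain ⟨hq, hpos, hmin⟩ := hpq
  have hle := hmin j' 1 m1 e1
  -- signs for column j'
  have D : ∀ k ∈ Finset.Icc 1 r, 0 < cEntry x p j' k → 0 < cEntry y p j' k := fun k hk h =>
    shi_det hx hS (fun p q h => (H j' p q).1 h)
      (fun p q h => shi_father_mem my p q ((H j' p q).1 h)) hp hk h
  have hpj : p ≠ j := by rintro rfl; exact hj hp
  have hpj' : p ≠ j' := by rintro rfl; exact hj' hp
  have hyp : y j' ≤ y p := by
    by_contra hc
    exact hj' (uy p hp j' (not_le.1 hc))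
  have hyp' : y j' ≠ y p := by
    rcases lt_or_gt_of_ne hpj' with a | a
    · exact (shi_ne hr hy a).symm
    · exact shi_ne hr hy a
  have Dq := D q hq
  rw [cEntry_of_gt y 1 hlt] at hle
  rcases lt_or_gt_of_ne hpj with a | a
  · rw [cEntry_of_lt _ _ (a.trans hlt), cEntry_of_lt _ _ (a.trans hlt)] at Dq
    rw [cEntry_of_lt _ _ a] at hle hxpos
    push_cast at hle
    have := Dq (by linarith)
    linarith
  · rw [cEntry_of_gt _ _ a] at hle hxpos
    push_cast at hle
    rcases lt_or_gt_of_ne hpj' with b | b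
    · simp only [Finset.mem_Icc] at hq
      obtain ⟨s, rfl⟩ : ∃ s, q = s + 1 := ⟨q - 1, by omega⟩
      push_cast at hle hxpos
      rcases Nat.eq_zero_or_pos s with rfl | hs
      · push_cast at hle
        exact hyp' (by linarith)
      · have Ds := D s (by simp; omega)
        rw [cEntry_of_lt _ _ b, cEntry_of_lt _ _ b] at Ds
        have := Ds (by linarith)
        linarith
    · rw [cEntry_of_gt _ _ b, cEntry_of_gt _ _ b] at Dq
      have := Dq (by linarith)
      linarith

theorem shi_induct {r n : ℕ} (hr : 0 < r) {x y : Fin n → ℝ}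
    (hx : x ∈ shiCompl r n) (hy : y ∈ shiCompl r n)
    (H : ∀ j p q, IsMinPosAt r x j p q ↔ IsMinPosAt r y j p q) (m : ℕ) (hm : m ≤ n) :
    ∃ T : Finset (Fin n), T.card = m ∧ ShiSame r T x y ∧ (∀ i ∈ T, ∀ l, x i < x l → l ∈ T) ∧
      (∀ i ∈ T, ∀ l, y i < y l → l ∈ T) := by
  classical
  induction m with
  | zero => exact ⟨∅, by simp, by intro i hi; simp at hi, by simp, by simp⟩
  | succ m ih =>
    obtain ⟨T, hc, hS, ux, uy⟩ := ih (by omega)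
    have hne : (Finset.univ \ T).Nonempty := by
      rw [← Finset.card_pos, Finset.card_sdiff_of_subset (Finset.subset_univ _)]
      simp; omega
    obtain ⟨j, hj, mx⟩ := Finset.exists_max_image _ x hne
    obtain ⟨j', hj', my⟩ := Finset.exists_max_image _ y hne
    simp only [Finset.mem_sdiff, Finset.mem_univ, true_and] at hj hj' mx my
    have hjj : j = j' := by
      rcases lt_trichotomy j j' with a | a | a
      · exact (shi_key hr hx hy H hS uy hj hj' mx my a).elim
      · exact a
      · exact (shi_key hr hy hx (fun j p q => (H j p q).symm) hS.symm ux hj' hj my mx a).elim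
    subst hjj
    refine ⟨insert j T, by rw [Finset.card_insert_of_notMem hj, hc], ?_, ?_, ?_⟩
    · intro i hi p hp k hk
      have hk1 := (Finset.mem_Icc.1 hk).1
      rcases Finset.mem_insert.1 hi with rfl | hiT <;> rcases Finset.mem_insert.1 hp with rfl | hpT
      · simp [cEntry]
      · constructor
        · intro h; exact (hj (ux p hpT _ (shi_pos_lt hk1 h))).elim
        · intro h; exact (hj (uy p hpT _ (shi_pos_lt hk1 h))).elim
      · constructor
        · exact shi_det hx hS (fun a b => (H _ a b).1) (shi_father_mem mx) hiT hk
        · exact shi_det hy hS.symm (fun a b => (H _ a b).2) (shi_father_mem my) hiT hk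
      · exact hS i hiT p hpT k hk
    · intro i hi l hl
      rcases Finset.mem_insert.1 hi with rfl | hi
      · by_contra hc
        have := mx l (fun h => hc (Finset.mem_insert_of_mem h))
        linarith
      · exact Finset.mem_insert_of_mem (ux i hi l hl)
    · intro i hi l hl
      rcases Finset.mem_insert.1 hi with rfl | hi
      · by_contra hc
        have := my l (fun h => hc (Finset.mem_insert_of_mem h))
        linarith
      · exact Finset.mem_insert_of_mem (uy i hi l hl)

theorem cEntry_comb {n : ℕ} (x y : Fin n → ℝ) (i j : Fin n) (k : ℕ) (a b : ℝ) (h : a + b = 1) :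
    cEntry (a • x + b • y) i j k = a * cEntry x i j k + b * cEntry y i j k := by
  obtain rfl : b = 1 - a := by linarith
  unfold cEntry
  split_ifs <;> simp <;> ring

theorem shi_segment {r n : ℕ} {x y : Fin n → ℝ}
    (hx : x ∈ shiCompl r n) (hy : y ∈ shiCompl r n) (hS : ShiSame r Finset.univ x y) :
    segment ℝ x y ⊆ shiCompl r n := by
  rintro z ⟨a, b, ha, hb, hab, rfl⟩ i j hij k hk
  rw [cEntry_comb _ _ _ _ _ _ _ hab]
  have s := hS i (Finset.mem_univ _) j (Finset.mem_univ _) k hk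
  have h1 := hx i j hij k hk
  have h2 := hy i j hij k hk
  rcases lt_or_gt_of_ne h1 with u | u
  · have v : cEntry y i j k < 0 := lt_of_le_of_ne (not_lt.1 fun h => by linarith [s.2 h]) h2
    rcases ha.eq_or_lt with rfl | ha
    · obtain rfl : b = 1 := by linarith
      linarith
    · nlinarith [mul_neg_of_pos_of_neg ha u, mul_nonneg hb (neg_nonneg.2 v.le)]
  · have v := s.1 u
    rcases ha.eq_or_lt with rfl | ha
    · obtain rfl : b = 1 := by linarith
      linarith
    · nlinarith [mul_pos ha u, mul_nonneg hb v.le]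

/-- Two regions of the `r`-Shi arrangement with the same father data `(p_j, q_j)` for all
`j` coincide; i.e., the map `Δ ↦ ((p_j(Δ), q_j(Δ)))_j` is injective on regions. -/
theorem region_determined_by_min_pos_data (r n : ℕ) (hr : 0 < r) (hn : 0 < n)
    (Δ Ω : ConnectedComponents ↥(shiCompl r n))
    (h : ∀ x y : ↥(shiCompl r n),
      ConnectedComponents.mk x = Δ → ConnectedComponents.mk y = Ω →
      ∀ j : Fin n,
        ((∃ i : Fin n, ∃ k ∈ Finset.Icc 1 r, 0 < cEntry x.val i j k) ↔
          (∃ i : Fin n, ∃ k ∈ Finset.Icc 1 r, 0 < cEntry y.val i j k)) ∧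
        ∀ p : Fin n, ∀ q : ℕ, IsMinPosAt r x.val j p q ↔ IsMinPosAt r y.val j p q) :
    Δ = Ω := by
  obtain ⟨x, rfl⟩ := ConnectedComponents.surjective_coe Δ
  obtain ⟨y, rfl⟩ := ConnectedComponents.surjective_coe Ω
  have H := fun j => (h x y rfl rfl j).2
  obtain ⟨T, hc, hS, -, -⟩ := shi_induct hr x.2 y.2 H n le_rfl
  obtain rfl : T = Finset.univ := by
    rw [← Finset.card_eq_iff_eq_univ, hc, Fintype.card_fin]
  have hseg := shi_segment x.2 y.2 hS
  have hpre : IsPreconnected (Subtype.val ⁻¹' (segment ℝ x.1 y.1) : Set ↥(shiCompl r n)) := by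
    rw [← Topology.IsInducing.subtypeVal.isPreconnected_image, Set.image_preimage_eq_of_subset]
    · exact (convex_segment _ _).isPreconnected
    · simpa using hseg
  rw [ConnectedComponents.coe_eq_coe']
  exact hpre.subset_connectedComponent (right_mem_segment ℝ x.1 y.1) (left_mem_segment ℝ x.1 y.1)
end
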